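/- Let F be a free group on a set 𝒳 and χ : F → ℝ a group homomorphism. For a reduced word w = x₁⋯xₙ over 𝒳^{±1}, define v_χ(w) = min over 1 ≤ j ≤ n of χ(x₁⋯xⱼ) (with v_χ of the empty word = 0). Then the set F(𝒳,χ) of elements of F represented by reduced words w with v_χ(w) ≥ 0 is a submonoid of F: if w₁, w₂ both have v_χ ≥ 0 then the reduced form of w₁w₂ has v_χ ≥ 0. -/

import Mathlib

namespace FreeGroup

/-- Every prefix of a word obtained by one cancellation represents the same element as some prefix
of the original word. -/
theorem Red.Step.exists_prefix_mk_eq {α : Type*} {L L' p : List (α × Bool)}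
    (h : Red.Step L L') (hp : p <+: L') : ∃ q, q <+: L ∧ mk q = mk p := by
  cases h with
  | @not A B x b =>
    obtain ⟨s, hs⟩ := hp
    rcases List.append_eq_append_iff.1 hs with ⟨t, rfl, rfl⟩ | ⟨t, rfl, rfl⟩
    · exact ⟨p, ⟨t ++ (x, b) :: (x, !b) :: B, by simp⟩, rfl⟩
    · exact ⟨A ++ (x, b) :: (x, !b) :: t, ⟨s, by simp⟩, Quot.sound Red.Step.not⟩

/-- Every prefix of a reduction of a word represents the same element as some prefix of the
original word. -/
theorem Red.exists_prefix_mk_eq {α : Type*} {L L' : List (α × Bool)}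
    (h : Red L L') {p : List (α × Bool)} (hp : p <+: L') : ∃ q, q <+: L ∧ mk q = mk p := by
  induction h generalizing p with
  | refl => exact ⟨p, hp, rfl⟩
  | tail _ hstep ih =>
    obtain ⟨q, hq, hqp⟩ := hstep.exists_prefix_mk_eq hp
    obtain ⟨r, hr, hrq⟩ := ih hq
    exact ⟨r, hr, hrq.trans hqp⟩

end FreeGroup


/-- For a character `χ` on a free group `F(𝒳)`, the set of elements
whose reduced word has all prefix `χ`-values nonnegative (`v_χ(w) ≥ 0`) is a
submonoid: it contains `1` and is closed under multiplication. -/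
theorem stmt13 {𝒳 : Type*} [DecidableEq 𝒳] (χ : FreeGroup 𝒳 → ℝ)
    (hχ : ∀ a b : FreeGroup 𝒳, χ (a * b) = χ a + χ b) :
    (1 : FreeGroup 𝒳) ∈ {w : FreeGroup 𝒳 |
        ∀ l₁ l₂ : List (𝒳 × Bool), w.toWord = l₁ ++ l₂ → 0 ≤ χ (FreeGroup.mk l₁)} ∧
      ∀ w₁ w₂ : FreeGroup 𝒳,
        w₁ ∈ {w : FreeGroup 𝒳 |
          ∀ l₁ l₂ : List (𝒳 × Bool), w.toWord = l₁ ++ l₂ → 0 ≤ χ (FreeGroup.mk l₁)} →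
        w₂ ∈ {w : FreeGroup 𝒳 |
          ∀ l₁ l₂ : List (𝒳 × Bool), w.toWord = l₁ ++ l₂ → 0 ≤ χ (FreeGroup.mk l₁)} →
        w₁ * w₂ ∈ {w : FreeGroup 𝒳 |
          ∀ l₁ l₂ : List (𝒳 × Bool), w.toWord = l₁ ++ l₂ → 0 ≤ χ (FreeGroup.mk l₁)} := by
  have h_one : χ 1 = 0 := by simpa using hχ 1 1
  refine ⟨fun l₁ l₂ h => ?_, fun w₁ w₂ h₁ h₂ l₁ l₂ h => ?_⟩
  · obtain ⟨rfl, -⟩ := List.append_eq_nil_iff.1 (h.symm.trans FreeGroup.toWord_one)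
    exact h_one.ge
  · rw [FreeGroup.toWord_mul] at h
    obtain ⟨q, ⟨s, hs⟩, hq⟩ :=
      FreeGroup.reduce.red.exists_prefix_mk_eq (p := l₁) ⟨l₂, h.symm⟩
    rw [← hq]
    rcases List.append_eq_append_iff.1 hs with ⟨t, ht, -⟩ | ⟨t, rfl, ht⟩
    · exact h₁ q t ht
    · rw [← FreeGroup.mul_mk, hχ]
      exact add_nonneg (h₁ _ [] (by simp)) (h₂ t s ht)
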